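/- If a function ψ ∈ T_n is bounded on (−∞,0)ⁿ, then for every complex Banach space X and all pairwise commuting generators A₁,…,Aₙ of C₀-semigroups with ‖Tⱼ(t)‖ ≤ M, the operator ψ(A) is a bounded operator on X, with operator norm bound depending (for fixed ψ) only on M. -/

import Mathlib

open MeasureTheory Filter Topology

noncomputable section

/-- A (one-parameter) `C₀`-semigroup of bounded operators on `X`. -/
def IsC0Semigroup {X : Type*} [NormedAddCommGroup X] [NormedSpace ℂ X]
    (T : ℝ → X →L[ℂ] X) : Prop :=
  T 0 = 1 ∧ (∀ s t : ℝ, 0 ≤ s → 0 ≤ t → T (s + t) = T s ∘L T t) ∧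
    ∀ x : X, Tendsto (fun t => T t x) (𝓝[≥] (0 : ℝ)) (𝓝 x)

/-- `InGenDomain T x y` means `x` belongs to the domain of the infinitesimal generator `A`
of the semigroup `T` and `A x = y`. -/
def InGenDomain {X : Type*} [NormedAddCommGroup X] [NormedSpace ℂ X]
    (T : ℝ → X →L[ℂ] X) (x y : X) : Prop :=
  Tendsto (fun t : ℝ => t⁻¹ • (T t x - x)) (𝓝[>] (0 : ℝ)) (𝓝 y)

/-- The `n`-parameter semigroup `T(u) = T₁(u₁) ⋯ Tₙ(uₙ)`. -/
def Tprod {X : Type*} [NormedAddCommGroup X] [NormedSpace ℂ X] {n : ℕ}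
    (T : Fin n → ℝ → X →L[ℂ] X) (u : Fin n → ℝ) : X →L[ℂ] X :=
  (List.ofFn fun j => T j (u j)).prod

/-- The open negative orthant `(-∞,0)ⁿ`. -/
def negOrthant (n : ℕ) : Set (Fin n → ℝ) := {s | ∀ j, s j < 0}

/-- The closed nonpositive orthant `(-∞,0]ⁿ`. -/
def nonposOrthant (n : ℕ) : Set (Fin n → ℝ) := {s | ∀ j, s j ≤ 0}

/-- A function of `n` variables is absolutely monotone on `(-∞,0)ⁿ` if it is nonnegative
together with all its iterated partial derivatives there. -/
def AbsMonotoneOn (n : ℕ) (f : (Fin n → ℝ) → ℝ) : Prop :=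
  ∀ (k : ℕ) (v : Fin k → Fin n) (s : Fin n → ℝ), s ∈ negOrthant n →
    0 ≤ iteratedFDerivWithin ℝ k f (negOrthant n) s (fun i => Pi.single (v i) 1)

/-- Membership in the class `𝒯ₙ` of (negative) Bernstein functions of `n` variables:
`ψ` is a nonpositive `C^∞`-function on `(-∞,0)ⁿ` all of whose first-order partial
derivatives are absolutely monotone. -/
def MemTn (n : ℕ) (ψ : (Fin n → ℝ) → ℝ) : Prop :=
  ContDiffOn ℝ (⊤ : ℕ∞) ψ (negOrthant n) ∧ (∀ s ∈ negOrthant n, ψ s ≤ 0) ∧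
    ∀ j : Fin n, AbsMonotoneOn n
      (fun s => fderivWithin ℝ ψ (negOrthant n) s (Pi.single j 1))

/-- The Lévy–Khintchine type representation
`ψ(s) = c₀ + c₁·s + ∫ (e^{s·u} - 1) dμ(u)` of a Bernstein function of `n` variables,
where `c₀ ≤ 0`, `c₁ ∈ ℝ₊ⁿ` and `μ` is a positive measure on `ℝ₊ⁿ \ {0}`. -/
def HasLevyRep (n : ℕ) (ψ : (Fin n → ℝ) → ℝ) (c₀ : ℝ) (c₁ : Fin n → ℝ)
    (μ : Measure (Fin n → ℝ)) : Prop :=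
  c₀ ≤ 0 ∧ (∀ j, 0 ≤ c₁ j) ∧ μ {u | ¬ ((∀ j, 0 ≤ u j) ∧ u ≠ 0)} = 0 ∧
    (∀ s ∈ negOrthant n, Integrable (fun u => Real.exp (∑ j, s j * u j) - 1) μ) ∧
    ∀ s ∈ negOrthant n, ψ s = c₀ + ∑ j, c₁ j * s j +
      ∫ u, (Real.exp (∑ j, s j * u j) - 1) ∂μ

/-- The family of bounded positive measures `ν_t` on `ℝ₊ⁿ` with
`∫ e^{s·u} dν_t(u) = e^{t ψ(s)}` (multidimensional Bernstein–Widder). -/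
def IsSubordinator (n : ℕ) (ψ : (Fin n → ℝ) → ℝ) (ν : ℝ → Measure (Fin n → ℝ)) : Prop :=
  ∀ t : ℝ, 0 ≤ t → IsFiniteMeasure (ν t) ∧ (ν t) {u | ¬ ∀ j, 0 ≤ u j} = 0 ∧
    ∀ s ∈ negOrthant n, ∫ u, Real.exp (∑ j, s j * u j) ∂(ν t) = Real.exp (t * ψ s)

/-- The holomorphic (complex) extension `ψ(λ) = c₀ + c₁·λ + ∫ (e^{λ·u} - 1) dμ(u)`
of a Bernstein function with representation `(c₀, c₁, μ)` to `{Re λ ≤ 0} ⊆ ℂⁿ`. -/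
def psiC (n : ℕ) (c₀ : ℝ) (c₁ : Fin n → ℝ) (μ : Measure (Fin n → ℝ))
    (l : Fin n → ℂ) : ℂ :=
  (c₀ : ℂ) + ∑ j, (c₁ j : ℂ) * l j +
    ∫ u, (Complex.exp (∑ j, l j * (u j : ℂ)) - 1) ∂μ

/-- The joint point spectrum of the tuple of generators of the semigroups `T j`. -/
def JointPointSpectrum {X : Type*} [NormedAddCommGroup X] [NormedSpace ℂ X] {n : ℕ}
    (T : Fin n → ℝ → X →L[ℂ] X) : Set (Fin n → ℂ) :=
  {l | ∃ x : X, x ≠ 0 ∧ ∀ j, InGenDomain (T j) x (l j • x)}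

/-- The joint approximate point spectrum of the tuple of generators of the `T j`. -/
def JointApproxSpectrum {X : Type*} [NormedAddCommGroup X] [NormedSpace ℂ X] {n : ℕ}
    (T : Fin n → ℝ → X →L[ℂ] X) : Set (Fin n → ℂ) :=
  {l | ∃ (x : ℕ → X) (y : Fin n → ℕ → X), (∀ m, ‖x m‖ = 1) ∧
    (∀ j m, InGenDomain (T j) (x m) (y j m)) ∧
    ∀ j, Tendsto (fun m => ‖y j m - l j • x m‖) atTop (𝓝 0)}

/-- The joint residual spectrum of the tuple of generators of the `T j`:
those `λ ∈ ℂⁿ` for which `Σⱼ Im (λⱼ - Aⱼ)` is not dense in `X`. -/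
def JointResidualSpectrum {X : Type*} [NormedAddCommGroup X] [NormedSpace ℂ X] {n : ℕ}
    (T : Fin n → ℝ → X →L[ℂ] X) : Set (Fin n → ℂ) :=
  {l | ¬ Dense (↑(Submodule.span ℂ
      (⋃ j, {z : X | ∃ x y, InGenDomain (T j) x y ∧ z = l j • x - y})) : Set X)}

/-- The point spectrum of a (possibly unbounded) operator given by its graph
relation `R x y ↔ (x ∈ D(B) ∧ B x = y)`. -/
def PointSpec {X : Type*} [NormedAddCommGroup X] [NormedSpace ℂ X]
    (R : X → X → Prop) : Set ℂ :=
  {α | ∃ x : X, x ≠ 0 ∧ R x (α • x)}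

/-- The approximate point spectrum of an operator given by its graph relation. -/
def ApproxSpec {X : Type*} [NormedAddCommGroup X] [NormedSpace ℂ X]
    (R : X → X → Prop) : Set ℂ :=
  {α | ∃ x y : ℕ → X, (∀ m, ‖x m‖ = 1) ∧ (∀ m, R (x m) (y m)) ∧
    Tendsto (fun m => ‖y m - α • x m‖) atTop (𝓝 0)}

/-- The residual spectrum of an operator given by its graph relation:
those `α` for which `Im (α - B)` is not dense. -/
def ResidualSpec {X : Type*} [NormedAddCommGroup X] [NormedSpace ℂ X]
    (R : X → X → Prop) : Set ℂ :=
  {α | ¬ Dense (↑(Submodule.span ℂ {z : X | ∃ x y, R x y ∧ z = α • x - y}) : Set X)}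

/-- The resolvent set of a closed operator given by its graph relation: `α` such that
`α - B : D(B) → X` has a bounded everywhere-defined inverse. -/
def ResolventSet {X : Type*} [NormedAddCommGroup X] [NormedSpace ℂ X]
    (R : X → X → Prop) : Set ℂ :=
  {α | ∃ Rv : X →L[ℂ] X, (∀ z : X, R (Rv z) (α • Rv z - z)) ∧
    ∀ x y : X, R x y → Rv (α • x - y) = x}

/-- The constant `K_M = (M+1)/(1 - e^{-(M+1)/M})` from the moment inequality. -/
def KM (M : ℝ) : ℝ := (M + 1) / (1 - Real.exp (-(M + 1) / M))

/-- The open sector `{z ≠ 0 : |arg z| < θ}` in `ℂ`. -/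
def Sector (θ : ℝ) : Set ℂ := {z | z ≠ 0 ∧ |Complex.arg z| < θ}

/-- A `C₀`-semigroup is holomorphic if it extends to a holomorphic semigroup on some
open sector around the positive half axis, strongly continuous at `0` in the sector. -/
def IsHolomorphicSemigroup {X : Type*} [NormedAddCommGroup X] [NormedSpace ℂ X]
    (T : ℝ → X →L[ℂ] X) : Prop :=
  ∃ (θ : ℝ) (S : ℂ → X →L[ℂ] X), 0 < θ ∧ (∀ t : ℝ, 0 < t → S t = T t) ∧
    (∀ z w : ℂ, z ∈ Sector θ → w ∈ Sector θ → S (z + w) = S z ∘L S w) ∧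
    DifferentiableOn ℂ S (Sector θ) ∧
    ∀ x : X, Tendsto (fun z => S z x) (𝓝[Sector θ] 0) (𝓝 x)

end

lemma aux_sg_cont {X : Type*} [NormedAddCommGroup X] [NormedSpace ℂ X]
    (T : ℝ → X →L[ℂ] X) (hT : IsC0Semigroup T) (M : ℝ)
    (hM : ∀ t, 0 ≤ t → ‖T t‖ ≤ M) (x : X) : ContinuousOn (fun t => T t x) (Set.Ici 0) := by
  obtain ⟨h0, hadd, hlim⟩ := hT
  have key : ∀ s t : ℝ, 0 ≤ s → 0 ≤ t → ‖T s x - T t x‖ ≤ M * ‖T |s - t| x - x‖ := by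
    have aux : ∀ s t : ℝ, 0 ≤ s → 0 ≤ t → t ≤ s → ‖T s x - T t x‖ ≤ M * ‖T |s - t| x - x‖ := by
      intro s t hs ht hst
      have h1 : T s x - T t x = T t (T |s - t| x - x) := by
        have := hadd t (s - t) ht (by linarith)
        rw [abs_of_nonneg (by linarith : 0 ≤ s - t), map_sub]
        rw [show t + (s - t) = s by ring] at this
        rw [this]; rfl
      rw [h1]
      exact (T t).le_of_opNorm_le (hM t ht) _
    intro s t hs ht
    rcases le_total t s with h | h
    · exact aux s t hs ht h
    · rw [norm_sub_rev, abs_sub_comm]; exact aux t s ht hs h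
  intro t ht
  have h2 : Tendsto (fun s : ℝ => |s - t|) (𝓝[Set.Ici 0] t) (𝓝[≥] (0 : ℝ)) := by
    apply tendsto_nhdsWithin_of_tendsto_nhds_of_eventually_within
    · have : Continuous fun s : ℝ => |s - t| := by fun_prop
      have h := this.tendsto t
      simp only [sub_self, abs_zero] at h
      exact h.mono_left nhdsWithin_le_nhds
    · exact Eventually.of_forall fun s => Set.mem_Ici.2 (abs_nonneg _)
  have h3 := (hlim x).comp h2
  have h4 : Tendsto (fun s : ℝ => M * ‖T |s - t| x - x‖) (𝓝[Set.Ici 0] t) (𝓝 0) := by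
    have := ((h3.sub_const x).norm).const_mul M
    simpa using this
  rw [ContinuousWithinAt, tendsto_iff_norm_sub_tendsto_zero]
  refine squeeze_zero' (Eventually.of_forall fun s => norm_nonneg _) ?_ h4
  filter_upwards [self_mem_nhdsWithin] with s hs
  exact key s t hs ht

lemma aux_list {X : Type*} [NormedAddCommGroup X] [NormedSpace ℂ X] {E : Type*}
    [TopologicalSpace E] (S : Set E) (M : ℝ) (hM : 1 ≤ M) (l : List (E → X →L[ℂ] X))
    (hl : ∀ f ∈ l, (∀ u ∈ S, ‖f u‖ ≤ M) ∧ ∀ x, ContinuousOn (fun u => f u x) S) :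
    (∀ u ∈ S, ‖(l.map (fun f => f u)).prod‖ ≤ M ^ l.length) ∧
      ∀ x, ContinuousOn (fun u => (l.map (fun f => f u)).prod x) S := by
  induction l with
  | nil =>
    refine ⟨fun u _ => ?_, fun x => ?_⟩
    · rw [List.map_nil, List.prod_nil, List.length_nil, pow_zero]
      exact ContinuousLinearMap.norm_id_le (𝕜 := ℂ) (E := X)
    · simpa using continuousOn_const
  | cons f l ih =>
    obtain ⟨ih1, ih2⟩ := ih fun g hg => hl g (List.mem_cons_of_mem _ hg)
    obtain ⟨hf1, hf2⟩ := hl f List.mem_cons_self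
    refine ⟨fun u hu => ?_, fun x => ?_⟩
    · rw [List.map_cons, List.prod_cons, List.length_cons, pow_succ']
      exact (norm_mul_le _ _).trans
        (mul_le_mul (hf1 u hu) (ih1 u hu) (norm_nonneg _) (by linarith))
    · intro u₀ hu₀
      set g : E → X →L[ℂ] X := fun u => (l.map (fun f => f u)).prod with hg
      have e : (fun u => ((f :: l).map (fun f => f u)).prod x) = fun u => f u (g u x) := by
        funext u
        rw [List.map_cons, List.prod_cons]; rfl
      rw [e, ContinuousWithinAt, tendsto_iff_norm_sub_tendsto_zero]
      have h1 : Tendsto (fun u => ‖g u x - g u₀ x‖) (𝓝[S] u₀) (𝓝 0) :=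
        tendsto_iff_norm_sub_tendsto_zero.1 (ih2 x u₀ hu₀)
      have h2 : Tendsto (fun u => ‖f u (g u₀ x) - f u₀ (g u₀ x)‖) (𝓝[S] u₀) (𝓝 0) :=
        tendsto_iff_norm_sub_tendsto_zero.1 (hf2 (g u₀ x) u₀ hu₀)
      have h3 := (h1.const_mul M).add h2
      simp only [mul_zero, add_zero] at h3
      refine squeeze_zero' (Eventually.of_forall fun s => norm_nonneg _) ?_ h3
      filter_upwards [self_mem_nhdsWithin] with u hu
      have h4 : f u (g u x) - f u₀ (g u₀ x)
          = f u (g u x - g u₀ x) + (f u (g u₀ x) - f u₀ (g u₀ x)) := by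
        rw [map_sub]; abel
      rw [h4]
      exact (norm_add_le _ _).trans
        (add_le_add ((f u).le_of_opNorm_le (hf1 u hu) _) le_rfl)

lemma aux_Tprod {X : Type*} [NormedAddCommGroup X] [NormedSpace ℂ X] {n : ℕ}
    (T : Fin n → ℝ → X →L[ℂ] X) (hT : ∀ j, IsC0Semigroup (T j)) (M : ℝ) (hM1 : 1 ≤ M)
    (hM : ∀ j t, 0 ≤ t → ‖T j t‖ ≤ M) :
    (∀ u ∈ {u : Fin n → ℝ | ∀ j, 0 ≤ u j}, ‖Tprod T u‖ ≤ M ^ n) ∧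
      ∀ x, ContinuousOn (fun u => Tprod T u x) {u : Fin n → ℝ | ∀ j, 0 ≤ u j} := by
  have h := aux_list (X := X) {u : Fin n → ℝ | ∀ j, 0 ≤ u j} M hM1
    (List.ofFn fun j => fun u : Fin n → ℝ => T j (u j)) (by
      intro f hf
      rw [List.mem_ofFn] at hf
      obtain ⟨j, rfl⟩ := hf
      refine ⟨fun u hu => hM j _ (hu j), fun x => ?_⟩
      exact (aux_sg_cont (T j) (hT j) M (hM j) x).comp
        (continuous_apply j).continuousOn (fun u hu => hu j))
  simp only [List.map_ofFn, List.length_ofFn] at h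
  exact h

lemma aux_levy {n : ℕ} (ψ : (Fin n → ℝ) → ℝ) (c₀ : ℝ) (c₁ : Fin n → ℝ)
    (μ : MeasureTheory.Measure (Fin n → ℝ)) (hrep : HasLevyRep n ψ c₀ c₁ μ)
    (hbd : ∃ K : ℝ, ∀ s ∈ negOrthant n, |ψ s| ≤ K) :
    (∀ j, c₁ j = 0) ∧ IsFiniteMeasure μ := by
  obtain ⟨hc0, hc1, hsupp, hint, hψ⟩ := hrep
  obtain ⟨K, hK⟩ := hbd
  have hae : ∀ᵐ u ∂μ, (∀ j, 0 ≤ u j) ∧ u ≠ 0 := hsupp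
  set s : ℕ → Fin n → ℝ := fun k _ => -((k : ℝ) + 1) with hs
  have hsn : ∀ k, s k ∈ negOrthant n := fun k j => by
    show -((k : ℝ) + 1) < 0
    have : (0 : ℝ) ≤ k := k.cast_nonneg
    linarith
  have hle : ∀ k, ∀ᵐ u ∂μ, 0 ≤ 1 - Real.exp (∑ j, s k j * u j) := by
    intro k
    filter_upwards [hae] with u hu
    have : ∑ j, s k j * u j ≤ 0 :=
      Finset.sum_nonpos fun j _ => mul_nonpos_of_nonpos_of_nonneg (hsn k j).le (hu.1 j)
    have := Real.exp_le_one_iff.2 this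
    linarith
  have hI0 : ∀ k, 0 ≤ ∫ u, (1 - Real.exp (∑ j, s k j * u j)) ∂μ :=
    fun k => integral_nonneg_of_ae (hle k)
  have hIneg : ∀ k, ∫ u, (Real.exp (∑ j, s k j * u j) - 1) ∂μ
      = - ∫ u, (1 - Real.exp (∑ j, s k j * u j)) ∂μ := by
    intro k
    rw [← integral_neg]; congr 1; funext u; ring
  have hsum : ∀ k, ∑ j, c₁ j * s k j = -(((k : ℝ) + 1) * ∑ j, c₁ j) := by
    intro k
    rw [← neg_mul, Finset.mul_sum]
    exact Finset.sum_congr rfl fun j _ => mul_comm _ _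
  have hC : 0 ≤ ∑ j, c₁ j := Finset.sum_nonneg fun j _ => hc1 j
  have hmain : ∀ k : ℕ, ((k : ℝ) + 1) * ∑ j, c₁ j +
      ∫ u, (1 - Real.exp (∑ j, s k j * u j)) ∂μ ≤ K := by
    intro k
    have h1 := (abs_le.1 (hK _ (hsn k))).1
    rw [hψ _ (hsn k), hsum, hIneg] at h1
    linarith
  constructor
  · have hz : ∑ j, c₁ j = 0 := by
      by_contra hne
      have hpos : 0 < ∑ j, c₁ j := lt_of_le_of_ne hC (Ne.symm hne)
      obtain ⟨k, hk⟩ := exists_nat_gt (K / ∑ j, c₁ j)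
      rw [div_lt_iff₀ hpos] at hk
      have := hmain k
      have := hI0 k
      nlinarith
    intro j
    exact (Finset.sum_eq_zero_iff_of_nonneg fun j _ => hc1 j).1 hz j (Finset.mem_univ j)
  · set f : ℕ → (Fin n → ℝ) → ENNReal :=
      fun k u => ENNReal.ofReal (1 - Real.exp (∑ j, s k j * u j)) with hf
    have hfm : ∀ k, Measurable (f k) := by
      intro k
      simp only [hf]
      fun_prop
    have hfle : ∀ k, ∫⁻ u, f k u ∂μ ≤ ENNReal.ofReal K := by
      intro k
      have hi : Integrable (fun u => 1 - Real.exp (∑ j, s k j * u j)) μ := by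
        have := (hint _ (hsn k)).neg
        refine this.congr (Eventually.of_forall fun u => ?_)
        simp
      rw [← ofReal_integral_eq_lintegral_ofReal hi (hle k)]
      apply ENNReal.ofReal_le_ofReal
      have h1 := hmain k
      have : 0 ≤ ((k : ℝ) + 1) * ∑ j, c₁ j := by positivity
      linarith
    have hlim : ∀ᵐ u ∂μ, liminf (fun k => f k u) atTop = 1 := by
      filter_upwards [hae] with u hu
      have hpos : 0 < ∑ j, u j := by
        obtain ⟨j, hj⟩ := Function.ne_iff.1 hu.2
        exact Finset.sum_pos' (fun j _ => hu.1 j)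
          ⟨j, Finset.mem_univ j, lt_of_le_of_ne (hu.1 j) (Ne.symm hj)⟩
      have he : ∀ k, ∑ j, s k j * u j = -(((k : ℝ) + 1) * ∑ j, u j) := by
        intro k
        rw [← neg_mul, Finset.mul_sum]
      have h1 : Tendsto (fun k : ℕ => ((k : ℝ) + 1) * ∑ j, u j) atTop atTop :=
        (tendsto_atTop_add_const_right _ _ tendsto_natCast_atTop_atTop).atTop_mul_const hpos
      have h2 : Tendsto (fun k => 1 - Real.exp (∑ j, s k j * u j)) atTop (𝓝 (1 - 0)) := by
        simp only [he]
        exact (Real.tendsto_exp_neg_atTop_nhds_zero.comp h1).const_sub 1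
      have h3 := ENNReal.tendsto_ofReal h2
      simp only [sub_zero, ENNReal.ofReal_one] at h3
      exact h3.liminf_eq
    refine ⟨?_⟩
    calc μ Set.univ = ∫⁻ u, liminf (fun k => f k u) atTop ∂μ := by
          rw [lintegral_congr_ae hlim]; simp
      _ ≤ liminf (fun k => ∫⁻ u, f k u ∂μ) atTop := lintegral_liminf_le hfm
      _ ≤ liminf (fun _ : ℕ => ENNReal.ofReal K) atTop :=
          liminf_le_liminf (Eventually.of_forall hfle)
      _ = ENNReal.ofReal K := liminf_const _
      _ < ⊤ := ENNReal.ofReal_lt_top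

/-- If `ψ ∈ 𝒯ₙ` is bounded on `(-∞,0)ⁿ`, then for every complex Banach
space `X` and all pairwise commuting generators `A₁,…,Aₙ` of `C₀`-semigroups with
`‖Tⱼ(t)‖ ≤ M`, the operator `ψ(A)` is bounded on `X` (it extends to a continuous operator
`B` on `X` agreeing with the representation formula on `D(A)`), with a norm bound `C`
depending, for fixed `ψ`, only on `M`. -/
theorem bounded_of_bounded_bernstein.{u}
    {n : ℕ} (ψ : (Fin n → ℝ) → ℝ) (c₀ : ℝ) (c₁ : Fin n → ℝ)
    (μ : MeasureTheory.Measure (Fin n → ℝ))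
    (hψ : MemTn n ψ) (hrep : HasLevyRep n ψ c₀ c₁ μ)
    (hbd : ∃ K : ℝ, ∀ s ∈ negOrthant n, |ψ s| ≤ K)
    (M : ℝ) (hM1 : 1 ≤ M) :
    ∃ C : ℝ, ∀ (X : Type u) [NormedAddCommGroup X] [NormedSpace ℂ X] [CompleteSpace X],
      ∀ (T : Fin n → ℝ → X →L[ℂ] X),
      (∀ j, IsC0Semigroup (T j)) →
      (∀ i j s t, 0 ≤ s → 0 ≤ t → T i s ∘L T j t = T j t ∘L T i s) →
      (∀ j t, 0 ≤ t → ‖T j t‖ ≤ M) →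
      ∃ B : X →L[ℂ] X, ‖B‖ ≤ C ∧
        ∀ (x : X) (y : Fin n → X), (∀ j, InGenDomain (T j) x (y j)) →
          B x = c₀ • x + (∑ j, c₁ j • y j) + ∫ u, (Tprod T u x - x) ∂μ := by
  obtain ⟨hc1, hfin⟩ := aux_levy ψ c₀ c₁ μ hrep hbd
  refine ⟨|c₀| + (M ^ n + 1) * μ.real Set.univ, ?_⟩
  intro X _ _ _ T hT _ hTM
  obtain ⟨hb, hcont⟩ := aux_Tprod T hT M hM1 hTM
  have hae : ∀ᵐ u ∂μ, u ∈ {u : Fin n → ℝ | ∀ j, 0 ≤ u j} := by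
    have h : ∀ᵐ u ∂μ, (∀ j, 0 ≤ u j) ∧ u ≠ 0 := hrep.2.2.1
    filter_upwards [h] with u hu using hu.1
  have hmeas : MeasurableSet {u : Fin n → ℝ | ∀ j, 0 ≤ u j} := by
    have : {u : Fin n → ℝ | ∀ j, 0 ≤ u j} = Set.Ici 0 := by
      ext u; simp [Pi.le_def]
    rw [this]; exact measurableSet_Ici
  have hbound : ∀ x : X, ∀ᵐ u ∂μ, ‖Tprod T u x - x‖ ≤ (M ^ n + 1) * ‖x‖ := by
    intro x
    filter_upwards [hae] with u hu
    have := (Tprod T u).le_of_opNorm_le (hb u hu) x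
    have := norm_sub_le (Tprod T u x) x
    linarith
  have hint : ∀ x : X, Integrable (fun u => Tprod T u x - x) μ := by
    intro x
    have h1 : AEStronglyMeasurable (fun u => Tprod T u x) μ := by
      have := (hcont x).aestronglyMeasurable (μ := μ) hmeas
      rwa [Measure.restrict_eq_self_of_ae_mem hae] at this
    exact Integrable.of_bound (h1.sub aestronglyMeasurable_const) _ (hbound x)
  have hMn : 0 ≤ M ^ n := by positivity
  let L : X →ₗ[ℂ] X :=
    { toFun := fun x => c₀ • x + ∫ u, (Tprod T u x - x) ∂μ
      map_add' := by
        intro x y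
        have : (fun u => Tprod T u (x + y) - (x + y))
            = fun u => (Tprod T u x - x) + (Tprod T u y - y) := by
          funext u; rw [map_add]; abel
        simp only [this]
        rw [integral_add (hint x) (hint y), smul_add]
        abel
      map_smul' := by
        intro c x
        have : (fun u => Tprod T u (c • x) - (c • x))
            = fun u => c • (Tprod T u x - x) := by
          funext u; rw [map_smul, smul_sub]
        simp only [this, RingHom.id_apply]
        rw [integral_smul, smul_add, smul_comm] }
  refine ⟨L.mkContinuous (|c₀| + (M ^ n + 1) * μ.real Set.univ) ?_,
    LinearMap.mkContinuous_norm_le _ (by positivity) _, ?_⟩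
  · intro x
    show ‖c₀ • x + ∫ u, (Tprod T u x - x) ∂μ‖ ≤ _
    have h1 := norm_integral_le_of_norm_le_const (hbound x)
    have h2 := norm_add_le (c₀ • x) (∫ u, (Tprod T u x - x) ∂μ)
    rw [norm_smul, Real.norm_eq_abs] at h2
    linarith
  · intro x y _
    show c₀ • x + ∫ u, (Tprod T u x - x) ∂μ = _
    simp [hc1]
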